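/- arXiv:2201.10793 — 3 statements merged into one kernel-verified Lean document; each statement's English description precedes it below -/
import Mathlib

section
/- For all w, x, y, z ∈ V, the fourfold trace identity holds for the action c̄: tr(c̄(w)∘c̄(x)∘c̄(y)∘c̄(z)) = 2^n·(⟨w,x⟩⟨y,z⟩ − ⟨w,y⟩⟨x,z⟩ + ⟨w,z⟩⟨x,y⟩). -/
open scoped RealInnerProductSpace

noncomputable section

variable {V : Type*} [NormedAddCommGroup V] [InnerProductSpace ℝ V]

/-- Left exterior multiplication `ε(v)` on the exterior algebra `ΛV`. -/
def extMul (v : V) : Module.End ℝ (ExteriorAlgebra ℝ V) :=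
  LinearMap.mulLeft ℝ (ExteriorAlgebra.ι ℝ v)

/-- Interior multiplication (contraction) `ι(v)` on the exterior algebra `ΛV`:
the unique antiderivation with `ι(v) w = ⟪v, w⟫` for `w ∈ V`. -/
def intMul (v : V) : Module.End ℝ (ExteriorAlgebra ℝ V) :=
  CliffordAlgebra.contractLeft (Q := (0 : QuadraticForm ℝ V)) (innerₛₗ ℝ v)

/-- The Clifford action `c(v) = ε(v) - ι(v)`. -/
def cl (v : V) : Module.End ℝ (ExteriorAlgebra ℝ V) := extMul v - intMul v

/-- The Clifford action `c̄(v) = ε(v) + ι(v)`. -/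
def clBar (v : V) : Module.End ℝ (ExteriorAlgebra ℝ V) := extMul v + intMul v

/-- Trace of an endomorphism of `ΛV`. -/
abbrev trΛ : Module.End ℝ (ExteriorAlgebra ℝ V) →ₗ[ℝ] ℝ :=
  LinearMap.trace ℝ (ExteriorAlgebra ℝ V)

theorem finrank_exteriorAlgebra [FiniteDimensional ℝ V] :
    Module.finrank ℝ (ExteriorAlgebra ℝ V) = 2 ^ Module.finrank ℝ V := by
  rw [Module.finrank_eq_card_basis (Module.finBasis ℝ V).ExteriorAlgebra, Fintype.card_finset,
    Fintype.card_fin]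

theorem extMul_mul_extMul (v w : V) : extMul v * extMul w = -(extMul w * extMul v) := by
  rw [eq_neg_iff_add_eq_zero]
  refine LinearMap.ext fun a => ?_
  simp only [extMul, LinearMap.add_apply, Module.End.mul_apply, LinearMap.mulLeft_apply,
    LinearMap.zero_apply]
  rw [← mul_assoc, ← mul_assoc, ← add_mul, ExteriorAlgebra.ι_add_mul_swap, zero_mul]

theorem intMul_mul_intMul (v w : V) : intMul v * intMul w = -(intMul w * intMul v) := by
  refine LinearMap.ext fun a => ?_
  exact CliffordAlgebra.contractLeft_comm _ _ a

theorem intMul_mul_extMul (v w : V) :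
    intMul v * extMul w = ⟪v, w⟫ • 1 - extMul w * intMul v := by
  refine LinearMap.ext fun a => ?_
  exact CliffordAlgebra.contractLeft_ι_mul _ w a

/-- The Clifford relation for `c̄`. -/
theorem clBar_mul_clBar (v w : V) :
    clBar v * clBar w = (2 * ⟪v, w⟫) • 1 - clBar w * clBar v := by
  simp only [clBar, add_mul, mul_add]
  rw [extMul_mul_extMul v w, intMul_mul_intMul v w, intMul_mul_extMul v w,
    intMul_mul_extMul w v, real_inner_comm v w]
  module

theorem trace_clBar_two [FiniteDimensional ℝ V] (v w : V) :
    trΛ (clBar v * clBar w) = (2 : ℝ) ^ Module.finrank ℝ V * ⟪v, w⟫ := by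
  have h := congrArg trΛ (clBar_mul_clBar v w)
  have : Module.Finite ℝ (ExteriorAlgebra ℝ V) :=
    .of_basis (Module.finBasis ℝ V).ExteriorAlgebra
  rw [map_sub, map_smul, LinearMap.trace_one, finrank_exteriorAlgebra,
    LinearMap.trace_mul_comm ℝ (clBar w)] at h
  push_cast [smul_eq_mul] at h
  linarith

theorem trace_cliffordBar_four [FiniteDimensional ℝ V] (w x y z : V) :
    trΛ (clBar w ∘ₗ clBar x ∘ₗ clBar y ∘ₗ clBar z)
      = (2 : ℝ) ^ Module.finrank ℝ V *
          (⟪w, x⟫ * ⟪y, z⟫ - ⟪w, y⟫ * ⟪x, z⟫ + ⟪w, z⟫ * ⟪x, y⟫) := by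
  have h : clBar w * (clBar x * (clBar y * clBar z)) =
      (2 * ⟪w, x⟫) • (clBar y * clBar z) - (2 * ⟪w, y⟫) • (clBar x * clBar z)
        + (2 * ⟪w, z⟫) • (clBar x * clBar y) - clBar x * (clBar y * clBar z) * clBar w := by
    rw [← mul_assoc, clBar_mul_clBar w x, sub_mul, mul_assoc (clBar x) (clBar w),
      ← mul_assoc (clBar w), clBar_mul_clBar w y, sub_mul, mul_assoc (clBar y) (clBar w),
      clBar_mul_clBar w z]
    simp only [mul_sub, smul_mul_assoc, mul_smul_comm, one_mul, mul_one, mul_assoc]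
    abel
  have ht := congrArg trΛ h
  rw [map_sub, LinearMap.trace_mul_comm ℝ (clBar x * _) (clBar w)] at ht
  simp only [map_add, map_sub, map_smul, trace_clBar_two, smul_eq_mul] at ht
  change trΛ (clBar w * (clBar x * (clBar y * clBar z))) = _
  linarith
end
end

section
/- Let (e_1,…,e_n) be an orthonormal basis of V and X, Y ∈ V. Then Σ_{j=1}^n tr(c(X)∘c(Y)∘c(e_j)∘c(X)∘c(Y)∘c(e_j)) = 2^n·[(n−4)·‖X‖²‖Y‖² + (4−2n)·⟨X,Y⟩²]. -/
open scoped RealInnerProductSpace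

noncomputable section

variable {V : Type*} [NormedAddCommGroup V] [InnerProductSpace ℝ V]

theorem cl_mul_add_cl_mul (v w : V) :
    cl v * cl w + cl w * cl v = (-(2 * ⟪v, w⟫)) • (1 : Module.End ℝ (ExteriorAlgebra ℝ V)) := by
  have hεε : ExteriorAlgebra.ι ℝ v * ExteriorAlgebra.ι ℝ w
      = -(ExteriorAlgebra.ι ℝ w * ExteriorAlgebra.ι ℝ v) :=
    eq_neg_of_add_eq_zero_left (ExteriorAlgebra.ι_add_mul_swap v w)
  have hιε (u u' : V) (x : ExteriorAlgebra ℝ V) :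
      intMul u (ExteriorAlgebra.ι ℝ u' * x)
        = ⟪u, u'⟫ • x - ExteriorAlgebra.ι ℝ u' * intMul u x :=
    CliffordAlgebra.contractLeft_ι_mul _ u' x
  refine LinearMap.ext fun x ↦ ?_
  have hιι : intMul v (intMul w x) = -intMul w (intMul v x) :=
    CliffordAlgebra.contractLeft_comm _ _ x
  simp only [cl, extMul, LinearMap.add_apply, Module.End.mul_apply, LinearMap.sub_apply,
    LinearMap.mulLeft_apply, LinearMap.smul_apply, Module.End.one_apply, mul_sub,
    hιε, hιι, ← mul_assoc, hεε, real_inner_comm v w, neg_mul]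
  module

theorem cl_mul_self (v : V) :
    cl v * cl v = (-‖v‖ ^ 2) • (1 : Module.End ℝ (ExteriorAlgebra ℝ V)) := by
  have h := cl_mul_add_cl_mul v v
  rw [real_inner_self_eq_norm_sq, ← two_smul ℝ, ← mul_neg, mul_smul] at h
  exact smul_right_injective _ (two_ne_zero' ℝ) h

theorem trΛ_one [FiniteDimensional ℝ V] :
    trΛ (1 : Module.End ℝ (ExteriorAlgebra ℝ V)) = 2 ^ Module.finrank ℝ V := by
  let b := (Module.finBasis ℝ V).ExteriorAlgebra
  have := Module.Free.of_basis b
  have := Module.Finite.of_basis b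
  rw [trΛ, LinearMap.trace_one, Module.finrank_eq_card_basis b]
  simp

theorem trΛ_cl_mul_cl [FiniteDimensional ℝ V] (v w : V) :
    trΛ (cl v * cl w) = -(2 ^ Module.finrank ℝ V * ⟪v, w⟫) := by
  have h := congrArg trΛ (cl_mul_add_cl_mul v w)
  rw [map_add, map_smul, trΛ_one, LinearMap.trace_mul_comm ℝ (cl w), smul_eq_mul] at h
  linarith

theorem trΛ_cl_mul_cl_mul_cl_sq [FiniteDimensional ℝ V] (X Y w : V) :
    trΛ (cl X * (cl Y * (cl w * (cl X * (cl Y * cl w)))))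
      = 2 ^ Module.finrank ℝ V *
          (‖X‖ ^ 2 * ‖Y‖ ^ 2 * ‖w‖ ^ 2 - 2 * ⟪X, Y⟫ ^ 2 * ‖w‖ ^ 2 - 2 * ‖X‖ ^ 2 * ⟪Y, w⟫ ^ 2
            - 2 * ‖Y‖ ^ 2 * ⟪X, w⟫ ^ 2 + 4 * ⟪X, Y⟫ * ⟪X, w⟫ * ⟪Y, w⟫) := by
  have swap (u v : V) : cl u * cl v
      = (-(2 * ⟪u, v⟫)) • (1 : Module.End ℝ (ExteriorAlgebra ℝ V)) - cl v * cl u :=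
    eq_sub_of_add_eq (cl_mul_add_cl_mul u v)
  have sq (u : V) (z : Module.End ℝ (ExteriorAlgebra ℝ V)) :
      cl u * (cl u * z) = (-‖u‖ ^ 2) • z := by
    rw [← mul_assoc, cl_mul_self, smul_mul_assoc, one_mul]
  have swap' (u v : V) (z : Module.End ℝ (ExteriorAlgebra ℝ V)) :
      cl u * (cl v * z) = (-(2 * ⟪u, v⟫)) • z - cl v * (cl u * z) := by
    rw [← mul_assoc, swap, sub_mul, smul_mul_assoc, one_mul, mul_assoc]
  rw [swap' w X, swap' w Y, cl_mul_self w]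
  simp only [mul_sub, mul_smul_comm, mul_one, sq, swap' Y X, cl_mul_self, map_sub, map_smul,
    trΛ_cl_mul_cl, trΛ_one, smul_eq_mul, real_inner_comm X Y, real_inner_comm X w,
    real_inner_comm Y w]
  ring

theorem trace_sum_cc_XYj [FiniteDimensional ℝ V] (n : ℕ)
    (e : OrthonormalBasis (Fin n) ℝ V) (X Y : V) :
    ∑ j : Fin n,
        trΛ (cl X ∘ₗ cl Y ∘ₗ cl (e j) ∘ₗ cl X ∘ₗ cl Y ∘ₗ cl (e j))
      = (2 : ℝ) ^ n *
          (((n : ℝ) - 4) * ‖X‖ ^ 2 * ‖Y‖ ^ 2 + (4 - 2 * (n : ℝ)) * ⟪X, Y⟫ ^ 2) := by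
  have hn : Module.finrank ℝ V = n := by
    simpa using Module.finrank_eq_card_basis e.toBasis
  have hsq (v : V) : ∑ j, ⟪v, e j⟫ ^ 2 = ‖v‖ ^ 2 := by
    simpa using e.sum_sq_norm_inner_left v
  have hXY : ∑ j, ⟪X, e j⟫ * ⟪Y, e j⟫ = ⟪X, Y⟫ := by
    simpa only [real_inner_comm Y] using e.sum_inner_mul_inner X Y
  simp only [← Module.End.mul_eq_comp, trΛ_cl_mul_cl_mul_cl_sq, hn, e.norm_eq_one,
    ← Finset.mul_sum, Finset.sum_add_distrib, Finset.sum_sub_distrib, hsq, mul_assoc, hXY]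
  simp
  ring
end
end

section
/- Let (e_1,…,e_n) be an orthonormal basis of V and X, Y, Z ∈ V. Then Σ_{j=1}^n tr(c̄(X)∘c(Y)∘c(Z)∘c(e_j)∘c̄(X)∘c(Y)∘c(Z)∘c(e_j)) = 2^n·‖X‖²·[(4−n)·‖Y‖²‖Z‖² + (2n−4)·⟨Y,Z⟩²]. -/
open scoped RealInnerProductSpace

noncomputable section

variable {V : Type*} [NormedAddCommGroup V] [InnerProductSpace ℝ V]

section CliffordRelations

variable {A : Type*} [Ring A] [Algebra ℝ A]

theorem sub_anticommutator_sub_of_car {a b a' b' : A} {r : ℝ} (ha : a * a' + a' * a = 0)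
    (hb : b * b' + b' * b = 0) (h : b * a' + a' * b = r • 1) (h' : b' * a + a * b' = r • 1) :
    (a - b) * (a' - b') + (a' - b') * (a - b) = (-2 * r) • 1 := by
  have key : (a - b) * (a' - b') + (a' - b') * (a - b) = (a * a' + a' * a) + (b * b' + b' * b)
      - (b * a' + a' * b) - (b' * a + a * b') := by noncomm_ring
  rw [key, ha, hb, h, h']
  module

theorem add_anticommutator_sub_of_car {a b a' b' : A} {r : ℝ} (ha : a * a' + a' * a = 0)
    (hb : b * b' + b' * b = 0) (h : b * a' + a' * b = r • 1) (h' : b' * a + a * b' = r • 1) :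
    (a + b) * (a' - b') + (a' - b') * (a + b) = 0 := by
  have key : (a + b) * (a' - b') + (a' - b') * (a + b) = (a * a' + a' * a) - (b * b' + b' * b)
      + (b * a' + a' * b) - (b' * a + a * b') := by noncomm_ring
  rw [key, ha, hb, h, h']
  module

theorem add_mul_self_of_car {a b : A} {r : ℝ} (ha : a * a + a * a = 0) (hb : b * b + b * b = 0)
    (h : b * a + a * b = r • 1) : (a + b) * (a + b) = r • 1 := by
  have key : (2 : ℝ) • ((a + b) * (a + b)) = (a * a + a * a) + (b * b + b * b)
      + (2 : ℝ) • (b * a + a * b) := by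
    simp only [mul_add, add_mul]; module
  rw [ha, hb, h, zero_add, zero_add] at key
  exact smul_right_injective _ (two_ne_zero' ℝ) key

theorem anticommuting_mul_clifford_sq {c : V →ₗ[ℝ] A} {x : A} {r : ℝ} (hx : x * x = r • 1)
    (hxc : ∀ v, x * c v + c v * x = 0) (Y Z W : V) :
    x * (c Y * (c Z * (c W * (x * (c Y * (c Z * c W)))))) =
      (-r) • (c Y * c Z * (c W * (c Y * c Z * c W))) := by
  have h (v : V) (a : A) : c v * (x * a) = -(x * (c v * a)) := by
    rw [← mul_assoc, eq_neg_of_add_eq_zero_right (hxc v), neg_mul, mul_assoc]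
  simp only [h, mul_neg, neg_neg]
  rw [← mul_assoc x, hx]
  simp only [mul_assoc, smul_mul_assoc, one_mul, neg_smul]

theorem clifford_mul_self {c : V →ₗ[ℝ] A}
    (hc : ∀ v w, c v * c w + c w * c v = (-2 * ⟪v, w⟫) • 1)
    (v : V) : c v * c v = (-‖v‖ ^ 2) • 1 := by
  have h := hc v v
  rw [real_inner_self_eq_norm_sq] at h
  refine smul_right_injective _ (two_ne_zero' ℝ) ?_
  change (2 : ℝ) • _ = (2 : ℝ) • _
  rw [two_smul, h]
  module

theorem clifford_mul_swap {c : V →ₗ[ℝ] A}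
    (hc : ∀ v w, c v * c w + c w * c v = (-2 * ⟪v, w⟫) • 1)
    (v w : V) : c v * c w = -(c w * c v) - (2 * ⟪v, w⟫) • 1 := by
  rw [eq_sub_of_add_eq (hc v w)]
  module

theorem clifford_mul_mul_swap {c : V →ₗ[ℝ] A}
    (hc : ∀ v w, c v * c w + c w * c v = (-2 * ⟪v, w⟫) • 1)
    (Y Z v : V) :
    c Y * c Z * c v = c v * c Y * c Z + (2 * ⟪Y, v⟫) • c Z - (2 * ⟪Z, v⟫) • c Y := by
  rw [mul_assoc, clifford_mul_swap hc Z v, mul_sub, mul_neg, ← mul_assoc,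
    clifford_mul_swap hc Y v]
  simp only [sub_mul, neg_mul, smul_mul_assoc, mul_smul_comm, one_mul, mul_one]
  module

theorem sum_clifford_conj_mul {c : V →ₗ[ℝ] A}
    (hc : ∀ v w, c v * c w + c w * c v = (-2 * ⟪v, w⟫) • 1)
    {ι : Type*} [Fintype ι] (e : OrthonormalBasis ι ℝ V) (Y Z : V) :
    ∑ j, c (e j) * (c Y * c Z * c (e j)) =
      (4 - (Fintype.card ι : ℝ)) • (c Y * c Z) + (4 * ⟪Y, Z⟫) • 1 := by
  have hsum (v : V) : ∑ j, ⟪v, e j⟫ • c (e j) = c v := by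
    conv_rhs => rw [← e.sum_repr' v, map_sum]
    simp only [map_smul, real_inner_comm]
  have h (j : ι) : c (e j) * (c Y * c Z * c (e j)) =
      (-1 : ℝ) • (c Y * c Z) + (2 : ℝ) • ((⟪Y, e j⟫ • c (e j)) * c Z)
        - (2 : ℝ) • ((⟪Z, e j⟫ • c (e j)) * c Y) := by
    rw [clifford_mul_mul_swap hc, mul_sub, mul_add, ← mul_assoc, ← mul_assoc,
      clifford_mul_self hc]
    simp only [e.norm_eq_one, smul_mul_assoc, mul_smul_comm, one_mul]
    module
  simp only [h, Finset.sum_sub_distrib, Finset.sum_add_distrib, ← Finset.smul_sum,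
    ← Finset.sum_mul, hsum, Finset.sum_const, Finset.card_univ]
  rw [clifford_mul_swap hc Z Y, real_inner_comm, ← Nat.cast_smul_eq_nsmul ℝ, smul_mul_assoc]
  module

theorem clifford_mul_sq {c : V →ₗ[ℝ] A}
    (hc : ∀ v w, c v * c w + c w * c v = (-2 * ⟪v, w⟫) • 1)
    (Y Z : V) :
    c Y * c Z * (c Y * c Z) = (-(‖Y‖ ^ 2 * ‖Z‖ ^ 2)) • 1 - (2 * ⟪Y, Z⟫) • (c Y * c Z) := by
  have h : c Y * c Z * (c Y * c Z) = c Y * (c Z * c Y) * c Z := by noncomm_ring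
  have h' : c Y * (c Y * c Z) * c Z = (c Y * c Y) * (c Z * c Z) := by noncomm_ring
  rw [h, clifford_mul_swap hc Z Y, mul_sub, sub_mul, mul_neg, neg_mul, h',
    clifford_mul_self hc, clifford_mul_self hc, real_inner_comm]
  simp only [smul_mul_assoc, mul_smul_comm, mul_one]
  module

theorem trace_clifford_mul {c : V →ₗ[ℝ] A}
    (hc : ∀ v w, c v * c w + c w * c v = (-2 * ⟪v, w⟫) • 1)
    {τ : A →ₗ[ℝ] ℝ} (hτ : ∀ a b, τ (a * b) = τ (b * a)) (Y Z : V) :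
    τ (c Y * c Z) = -τ 1 * ⟪Y, Z⟫ := by
  have h := congrArg τ (hc Y Z)
  rw [map_add, hτ (c Z), map_smul, smul_eq_mul] at h
  linarith

theorem sum_trace_anticommuting_mul_clifford_sq {c : V →ₗ[ℝ] A}
    (hc : ∀ v w, c v * c w + c w * c v = (-2 * ⟪v, w⟫) • 1)
    {ι : Type*} [Fintype ι]
    (e : OrthonormalBasis ι ℝ V) {τ : A →ₗ[ℝ] ℝ} (hτ : ∀ a b, τ (a * b) = τ (b * a))
    {x : A} {r : ℝ} (hx : x * x = r • 1) (hxc : ∀ v, x * c v + c v * x = 0) (Y Z : V) :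
    ∑ j, τ (x * (c Y * (c Z * (c (e j) * (x * (c Y * (c Z * c (e j)))))))) =
      τ 1 * r * ((4 - (Fintype.card ι : ℝ)) * ‖Y‖ ^ 2 * ‖Z‖ ^ 2 +
        (2 * (Fintype.card ι : ℝ) - 4) * ⟪Y, Z⟫ ^ 2) := by
  simp only [anticommuting_mul_clifford_sq hx hxc]
  rw [← map_sum, ← Finset.smul_sum, ← Finset.mul_sum, sum_clifford_conj_mul hc e, mul_add,
    mul_smul_comm, mul_smul_comm, mul_one, clifford_mul_sq hc]
  simp only [map_smul, map_add, map_sub, trace_clifford_mul hc hτ, smul_eq_mul]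
  ring

end CliffordRelations

theorem extMul_mul_extMul_add (v w : V) : extMul v * extMul w + extMul w * extMul v = 0 := by
  refine LinearMap.ext fun x => ?_
  simp only [extMul, LinearMap.add_apply, Module.End.mul_apply, LinearMap.mulLeft_apply,
    LinearMap.zero_apply]
  rw [← mul_assoc, ← mul_assoc, ← add_mul, ExteriorAlgebra.ι_add_mul_swap, zero_mul]

theorem intMul_mul_intMul_add (v w : V) : intMul v * intMul w + intMul w * intMul v = 0 := by
  refine LinearMap.ext fun x => ?_
  simp only [intMul, LinearMap.add_apply, Module.End.mul_apply, LinearMap.zero_apply]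
  rw [CliffordAlgebra.contractLeft_comm, neg_add_cancel]

theorem intMul_mul_extMul_add (v w : V) :
    intMul v * extMul w + extMul w * intMul v = ⟪v, w⟫ • 1 := by
  refine LinearMap.ext fun x => ?_
  have h := CliffordAlgebra.contractLeft_ι_mul (Q := (0 : QuadraticForm ℝ V))
    (innerₛₗ ℝ v) w x
  simp only [intMul, extMul, LinearMap.add_apply, Module.End.mul_apply, LinearMap.mulLeft_apply,
    LinearMap.smul_apply, Module.End.one_apply]
  exact (congrArg (· + _) h).trans (sub_add_cancel _ _)

theorem extMul_mul_intMul_swap_add (v w : V) :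
    intMul w * extMul v + extMul v * intMul w = ⟪v, w⟫ • 1 := by
  rw [intMul_mul_extMul_add, real_inner_comm]

theorem cl_mul_cl_add (v w : V) : cl v * cl w + cl w * cl v = (-2 * ⟪v, w⟫) • 1 :=
  sub_anticommutator_sub_of_car (extMul_mul_extMul_add v w) (intMul_mul_intMul_add v w)
    (intMul_mul_extMul_add v w) (extMul_mul_intMul_swap_add v w)

theorem clBar_mul_cl_add (v w : V) : clBar v * cl w + cl w * clBar v = 0 :=
  add_anticommutator_sub_of_car (extMul_mul_extMul_add v w) (intMul_mul_intMul_add v w)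
    (intMul_mul_extMul_add v w) (extMul_mul_intMul_swap_add v w)

theorem clBar_mul_clBar_self (v : V) : clBar v * clBar v = (‖v‖ ^ 2) • 1 := by
  rw [← real_inner_self_eq_norm_sq]
  exact add_mul_self_of_car (extMul_mul_extMul_add v v) (intMul_mul_intMul_add v v)
    (intMul_mul_extMul_add v v)

/-- `cl` as a linear map. -/
def clₗ : V →ₗ[ℝ] Module.End ℝ (ExteriorAlgebra ℝ V) :=
  (LinearMap.mul ℝ (ExteriorAlgebra ℝ V)) ∘ₗ ExteriorAlgebra.ι ℝ -
    (CliffordAlgebra.contractLeft (Q := (0 : QuadraticForm ℝ V))) ∘ₗ innerₛₗ ℝ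

theorem trace_sum_cbarcc_XYZj [FiniteDimensional ℝ V] (n : ℕ)
    (e : OrthonormalBasis (Fin n) ℝ V) (X Y Z : V) :
    ∑ j : Fin n,
        trΛ (clBar X ∘ₗ cl Y ∘ₗ cl Z ∘ₗ cl (e j) ∘ₗ
              clBar X ∘ₗ cl Y ∘ₗ cl Z ∘ₗ cl (e j))
      = (2 : ℝ) ^ n * ‖X‖ ^ 2 *
          ((4 - (n : ℝ)) * ‖Y‖ ^ 2 * ‖Z‖ ^ 2 + (2 * (n : ℝ) - 4) * ⟪Y, Z⟫ ^ 2) := by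
  have hn : Module.finrank ℝ V = n := by
    simpa using Module.finrank_eq_card_basis e.toBasis
  have h := sum_trace_anticommuting_mul_clifford_sq (c := clₗ) cl_mul_cl_add e (τ := trΛ)
    (LinearMap.trace_mul_comm ℝ) (clBar_mul_clBar_self X) (clBar_mul_cl_add X) Y Z
  rw [Fintype.card_fin] at h
  rw [trΛ_one, hn] at h
  exact h
end
end
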